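/- Asymptotically efficient simulation (Corollary 4): assume that for each γ > 0 there exists a minimizer μ*(γ) ∈ ℝ^d of μ ↦ sup_{x∈𝒞_γ} ψ_γ(x;μ). Let f_γ(x) = φ_d(x)·1{x ∈ 𝒞_γ}/ℓ(γ) be the truncated standard normal density on 𝒞_γ, and let g_γ(x;μ) = Π_{k=1}^d [φ(x_k − μ_k)·1{x_k ≥ l̃ᵧ_k(x)} / (1 − Φ(l̃ᵧ_k(x) − μ_k))] be the tilted sequential proposal density (φ the standard normal density). Then the proposal converges to the target in total variation: sup over Borel sets 𝒜 ⊆ ℝ^d of |∫_𝒜 f_γ(x) dx − ∫_𝒜 g_γ(x;μ*(γ)) dx| → 0 as γ → ∞. -/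

import Mathlib

open MeasureTheory Real Filter Matrix

/-- Standard normal density on ℝ. -/
noncomputable def stdPdf (t : ℝ) : ℝ := (Real.sqrt (2 * Real.pi))⁻¹ * Real.exp (-t ^ 2 / 2)

/-- Standard normal cumulative distribution function Φ. -/
noncomputable def Phi (t : ℝ) : ℝ := ∫ s in Set.Iic t, stdPdf s

/-- Standard `d`-dimensional normal density φ_d(x) = (2π)^{-d/2} exp(-‖x‖²/2). -/
noncomputable def phiD {d : ℕ} (x : Fin d → ℝ) : ℝ :=
  ((Real.sqrt (2 * Real.pi)) ^ d)⁻¹ * Real.exp (-(∑ i, x i ^ 2) / 2)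

/-- The region of integration 𝒞_γ = {x : Lx ≥ γ Σ l*}, where Σ = LLᵀ. -/
def Cgam {d : ℕ} (L : Matrix (Fin d) (Fin d) ℝ) (lstar : Fin d → ℝ) (γ : ℝ) :
    Set (Fin d → ℝ) := {x | ∀ i, γ * (L * Lᵀ).mulVec lstar i ≤ L.mulVec x i}

/-- ℓ(γ) = P(LZ ≥ γ Σ l*) = ∫_{𝒞_γ} φ_d(x) dx. -/
noncomputable def ellGam {d : ℕ} (L : Matrix (Fin d) (Fin d) ℝ) (lstar : Fin d → ℝ)
    (γ : ℝ) : ℝ := ∫ x in Cgam L lstar γ, phiD x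

/-- One-sided sequential bound l̃ᵧ_k(x) = (γ(Σl*)_k − Σ_{j<k} L_{kj} x_j)/L_{kk}. -/
noncomputable def lTilGam {d : ℕ} (L : Matrix (Fin d) (Fin d) ℝ) (lstar : Fin d → ℝ) (γ : ℝ)
    (x : Fin d → ℝ) (k : Fin d) : ℝ :=
  (γ * (L * Lᵀ).mulVec lstar k - ∑ j ∈ Finset.Iio k, L k j * x j) / L k k

/-- ψ_γ(x;μ) = −xᵀμ + ‖μ‖²/2 + Σ_k log(1 − Φ(l̃ᵧ_k(x) − μ_k)). -/
noncomputable def psiGam {d : ℕ} (L : Matrix (Fin d) (Fin d) ℝ) (lstar : Fin d → ℝ) (γ : ℝ)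
    (x μ : Fin d → ℝ) : ℝ :=
  -(∑ i, x i * μ i) + (∑ i, μ i ^ 2) / 2 +
    ∑ k, Real.log (1 - Phi (lTilGam L lstar γ x k - μ k))

/-- Second moment of the exponentially tilted estimator with tilting parameter μ(γ):
M(γ) = ∫_{𝒞_γ} exp(ψ_γ(x;μ(γ))) φ_d(x) dx. -/
noncomputable def Mgam {d : ℕ} (L : Matrix (Fin d) (Fin d) ℝ) (lstar : Fin d → ℝ)
    (μ : ℝ → Fin d → ℝ) (γ : ℝ) : ℝ :=
  ∫ x in Cgam L lstar γ, Real.exp (psiGam L lstar γ x (μ γ)) * phiD x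

/-- Truncated standard normal density f_γ = φ_d·1{𝒞_γ}/ℓ(γ). -/
noncomputable def fTrunc {d : ℕ} (L : Matrix (Fin d) (Fin d) ℝ) (lstar : Fin d → ℝ)
    (γ : ℝ) (x : Fin d → ℝ) : ℝ :=
  Set.indicator (Cgam L lstar γ) phiD x / ellGam L lstar γ

/-- Tilted sequential proposal density
g_γ(x;μ) = Π_k φ(x_k − μ_k)·1{x_k ≥ l̃ᵧ_k(x)}/(1 − Φ(l̃ᵧ_k(x) − μ_k)). -/
noncomputable def gTilt {d : ℕ} (L : Matrix (Fin d) (Fin d) ℝ) (lstar : Fin d → ℝ)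
    (γ : ℝ) (x μ : Fin d → ℝ) : ℝ :=
  ∏ k, stdPdf (x k - μ k) * (if lTilGam L lstar γ x k ≤ x k then (1 : ℝ) else 0) /
    (1 - Phi (lTilGam L lstar γ x k - μ k))

lemma stdPdf_eq_gaussianPDFReal : stdPdf = ProbabilityTheory.gaussianPDFReal 0 1 := by
  funext t
  simp [stdPdf, ProbabilityTheory.gaussianPDFReal]

lemma stdPdf_pos (t : ℝ) : 0 < stdPdf t := by
  unfold stdPdf; positivity

lemma integrable_stdPdf : Integrable stdPdf := by
  rw [stdPdf_eq_gaussianPDFReal]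
  exact ProbabilityTheory.integrable_gaussianPDFReal 0 1

lemma integral_stdPdf : ∫ t, stdPdf t = 1 := by
  rw [stdPdf_eq_gaussianPDFReal]
  exact ProbabilityTheory.integral_gaussianPDFReal_eq_one 0 one_ne_zero

lemma one_sub_Phi (t : ℝ) : 1 - Phi t = ∫ s in Set.Ioi t, stdPdf s := by
  have h := integral_add_compl (measurableSet_Iic (a := t)) integrable_stdPdf
  rw [integral_stdPdf, Set.compl_Iic] at h
  unfold Phi
  linarith

lemma one_sub_Phi_pos (t : ℝ) : 0 < 1 - Phi t := by
  rw [one_sub_Phi, setIntegral_pos_iff_support_of_nonneg_ae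
    (Eventually.of_forall fun s => (stdPdf_pos s).le) integrable_stdPdf.integrableOn]
  have : Function.support stdPdf = Set.univ := by
    ext s; simp [(stdPdf_pos s).ne']
  simp [this]

/-- Exponential upper bound for the Gaussian tail, with arbitrary rate `r`. -/
lemma one_sub_Phi_le {r : ℝ} (hr : 0 < r) (s : ℝ) :
    1 - Phi s ≤ Real.exp (r ^ 2 / 2 - r * s) / (Real.sqrt (2 * Real.pi) * r) := by
  have hexp : IntegrableOn (fun y : ℝ => Real.exp (-r * y)) (Set.Ioi s) :=
    integrableOn_exp_mul_Ioi (by linarith) s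
  have hle : ∀ y, stdPdf y ≤
      (Real.sqrt (2 * Real.pi))⁻¹ * Real.exp (r ^ 2 / 2) * Real.exp (-r * y) := by
    intro y
    rw [stdPdf, mul_assoc, ← Real.exp_add]
    gcongr
    nlinarith [sq_nonneg (y - r)]
  calc 1 - Phi s = ∫ y in Set.Ioi s, stdPdf y := one_sub_Phi s
    _ ≤ ∫ y in Set.Ioi s,
        (Real.sqrt (2 * Real.pi))⁻¹ * Real.exp (r ^ 2 / 2) * Real.exp (-r * y) :=
      setIntegral_mono integrable_stdPdf.integrableOn (hexp.const_mul _) hle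
    _ = _ := by
      rw [integral_const_mul, integral_exp_mul_Ioi (by linarith) s, Real.exp_sub,
        neg_mul, Real.exp_neg]
      field_simp

/-- A product of sequential conditional densities on `ℝ^d` has total mass one. -/
lemma lintegral_prod_sequential : ∀ {d : ℕ} (F : Fin d → (Fin d → ℝ) → ENNReal),
    (∀ k, Measurable (F k)) →
    (∀ k x y, (∀ j ≤ k, x j = y j) → F k x = F k y) →
    (∀ k x, ∫⁻ t, F k (Function.update x k t) = 1) →
    ∫⁻ x, ∏ k, F k x = 1
  | 0, F, _, _, _ => by simp [volume_pi]
  | d + 1, F, hm, hdep, h1 => by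
    let e := MeasurableEquiv.piFinSuccAbove (fun _ : Fin (d + 1) => ℝ) (Fin.last d)
    have he : MeasurePreserving e.symm :=
      (volume_preserving_piFinSuccAbove (fun _ : Fin (d + 1) => ℝ) (Fin.last d)).symm
    have hes : ∀ p, e.symm p = Fin.snoc (α := fun _ => ℝ) p.2 p.1 := by
      intro p
      simp only [e, MeasurableEquiv.piFinSuccAbove, Fin.insertNthEquiv_last]
      rfl
    have hmsnoc : Measurable fun p : ℝ × (Fin d → ℝ) =>
        (Fin.snoc (α := fun _ => ℝ) p.2 p.1 : Fin (d + 1) → ℝ) := by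
      have := e.symm.measurable
      convert this using 1
      funext p
      exact (hes p).symm
    have hmsnoc0 : Measurable fun x : Fin d → ℝ =>
        (Fin.snoc (α := fun _ => ℝ) x (0 : ℝ) : Fin (d + 1) → ℝ) :=
      hmsnoc.comp (measurable_const.prodMk measurable_id)
    have hind : ∀ (k : Fin d) (x : Fin d → ℝ) (t : ℝ),
        F k.castSucc (Fin.snoc (α := fun _ => ℝ) x t) =
          F k.castSucc (Fin.snoc (α := fun _ => ℝ) x (0 : ℝ)) := by
      intro k x t
      refine hdep _ _ _ fun j hj => ?_
      obtain ⟨j', rfl⟩ := Fin.exists_castSucc_eq.2 (hj.trans_lt (Fin.castSucc_lt_last k)).ne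
      simp
    have hsplit : ∀ p : ℝ × (Fin d → ℝ), ∏ k, F k (e.symm p) =
        (∏ k : Fin d, F k.castSucc (Fin.snoc (α := fun _ => ℝ) p.2 (0 : ℝ))) *
          F (Fin.last d) (Fin.snoc (α := fun _ => ℝ) p.2 p.1) := by
      intro p
      rw [Fin.prod_univ_castSucc, hes]
      congr 1
      exact Finset.prod_congr rfl fun k _ => hind k _ _
    have hmprod : Measurable fun x : Fin d → ℝ =>
        ∏ k : Fin d, F k.castSucc (Fin.snoc (α := fun _ => ℝ) x (0 : ℝ)) :=
      Finset.measurable_prod _ fun k _ => (hm _).comp hmsnoc0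
    have hmlast : Measurable fun p : ℝ × (Fin d → ℝ) =>
        F (Fin.last d) (Fin.snoc (α := fun _ => ℝ) p.2 p.1) := (hm _).comp hmsnoc
    rw [← he.lintegral_comp_emb e.symm.measurableEmbedding]
    simp_rw [hsplit]
    rw [Measure.volume_eq_prod, lintegral_prod_symm
      (fun p : ℝ × (Fin d → ℝ) =>
        (∏ k : Fin d, F k.castSucc (Fin.snoc (α := fun _ => ℝ) p.2 (0 : ℝ))) *
          F (Fin.last d) (Fin.snoc (α := fun _ => ℝ) p.2 p.1))
      ((hmprod.comp measurable_snd).mul hmlast).aemeasurable]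
    have hinner : ∀ x : Fin d → ℝ,
        ∫⁻ t : ℝ, (∏ k : Fin d, F k.castSucc (Fin.snoc (α := fun _ => ℝ) x (0 : ℝ))) *
          F (Fin.last d) (Fin.snoc (α := fun _ => ℝ) x t) =
        ∏ k : Fin d, F k.castSucc (Fin.snoc (α := fun _ => ℝ) x (0 : ℝ)) := by
      intro x
      have hmx : Measurable fun t : ℝ =>
          F (Fin.last d) (Fin.snoc (α := fun _ => ℝ) x t) :=
        hmlast.comp (measurable_id.prodMk measurable_const)
      rw [lintegral_const_mul _ hmx]
      have := h1 (Fin.last d) (Fin.snoc (α := fun _ => ℝ) x (0 : ℝ))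
      simp only [Fin.update_snoc_last] at this
      rw [this, mul_one]
    simp_rw [hinner]
    refine lintegral_prod_sequential
      (fun k x => F k.castSucc (Fin.snoc (α := fun _ => ℝ) x (0 : ℝ)))
      (fun k => (hm _).comp hmsnoc0) (fun k x y hxy => ?_) (fun k x => ?_)
    · refine hdep _ _ _ fun j hj => ?_
      obtain ⟨j', rfl⟩ := Fin.exists_castSucc_eq.2 (hj.trans_lt (Fin.castSucc_lt_last k)).ne
      simpa using hxy j' (by simpa using hj)
    · have := h1 k.castSucc (Fin.snoc (α := fun _ => ℝ) x (0 : ℝ))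
      simpa only [Fin.snoc_update] using this

section Sequential

variable {d : ℕ} {L : Matrix (Fin d) (Fin d) ℝ} {lstar : Fin d → ℝ} {γ : ℝ}

lemma measurable_lTilGam (k : Fin d) : Measurable fun x => lTilGam L lstar γ x k := by
  unfold lTilGam
  fun_prop

lemma lTilGam_congr {k : Fin d} {x y : Fin d → ℝ} (h : ∀ j < k, x j = y j) :
    lTilGam L lstar γ x k = lTilGam L lstar γ y k := by
  unfold lTilGam
  congr 2
  exact Finset.sum_congr rfl fun j hj => by rw [h j (Finset.mem_Iio.1 hj)]

/-- Sampling each coordinate from a density `q k` truncated to `[l̃ᵧ_k(x), ∞)` gives a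
probability density on `ℝ^d`. -/
lemma integral_sequential_truncated (q Z : Fin d → ℝ → ℝ) (hq : ∀ k t, 0 ≤ q k t)
    (hqm : ∀ k, Measurable (q k)) (hqi : ∀ k a, IntegrableOn (q k) (Set.Ioi a))
    (hZ : ∀ k a, ∫ t in Set.Ioi a, q k t = Z k a) (hZpos : ∀ k a, 0 < Z k a) :
    let G := fun x : Fin d → ℝ => ∏ k, q k (x k) *
      (if lTilGam L lstar γ x k ≤ x k then (1 : ℝ) else 0) / Z k (lTilGam L lstar γ x k)
    Integrable G ∧ ∫ x, G x = 1 := by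
  intro G
  have hZm : ∀ k, Measurable (Z k) := fun k => by
    refine Antitone.measurable fun a b hab => ?_
    rw [← hZ, ← hZ]
    exact setIntegral_mono_set (hqi k a) (Eventually.of_forall (hq k))
      (Set.Ioi_subset_Ioi hab).eventuallyLE
  let F : Fin d → (Fin d → ℝ) → ℝ := fun k x => q k (x k) *
      (if lTilGam L lstar γ x k ≤ x k then (1 : ℝ) else 0) / Z k (lTilGam L lstar γ x k)
  have hF0 : ∀ k x, 0 ≤ F k x := fun k x =>
    div_nonneg (mul_nonneg (hq _ _) (by split_ifs <;> norm_num)) (hZpos _ _).le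
  have hFm : ∀ k, Measurable (F k) := fun k => by
    refine Measurable.div (((hqm k).comp (measurable_pi_apply k)).mul ?_)
      ((hZm k).comp (measurable_lTilGam k))
    exact Measurable.ite (measurableSet_le (measurable_lTilGam k) (measurable_pi_apply k))
      measurable_const measurable_const
  have hG0 : ∀ x, 0 ≤ G x := fun x => Finset.prod_nonneg fun k _ => hF0 k x
  have hGm : Measurable G := Finset.measurable_prod _ fun k _ => hFm k
  have hmass : ∫⁻ x, ENNReal.ofReal (G x) = 1 := by
    have hprod : ∀ x, ENNReal.ofReal (G x) = ∏ k, ENNReal.ofReal (F k x) := fun x =>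
      ENNReal.ofReal_prod_of_nonneg fun k _ => hF0 k x
    simp_rw [hprod]
    refine lintegral_prod_sequential (fun k x => ENNReal.ofReal (F k x))
      (fun k => (hFm k).ennreal_ofReal) (fun k x y hxy => ?_) (fun k x => ?_)
    · simp only [F]
      rw [lTilGam_congr fun j hj => hxy j hj.le, hxy k le_rfl]
    · set a := lTilGam L lstar γ x k with ha
      have hval : ∀ t, F k (Function.update x k t) =
          (Set.Ici a).indicator (fun t => q k t / Z k a) t := by
        intro t
        have hl : lTilGam L lstar γ (Function.update x k t) k = a :=
          lTilGam_congr fun j hj => Function.update_of_ne hj.ne _ _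
        simp only [F, hl, Function.update_self, Set.indicator, Set.mem_Ici]
        split_ifs <;> simp
      simp_rw [hval]
      have hint : IntegrableOn (fun t => q k t / Z k a) (Set.Ici a) :=
        ((integrableOn_Ici_iff_integrableOn_Ioi (by simp)).2 (hqi k a)).div_const _
      rw [← ofReal_integral_eq_lintegral_ofReal
        ((integrable_indicator_iff measurableSet_Ici).2 hint)
        (Eventually.of_forall fun t => Set.indicator_nonneg
          (fun t _ => div_nonneg (hq k t) (hZpos k a).le) t),
        integral_indicator measurableSet_Ici, integral_Ici_eq_integral_Ioi,
        integral_div, hZ, div_self (hZpos k a).ne', ENNReal.ofReal_one]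
  refine ⟨⟨hGm.aestronglyMeasurable, ?_⟩, ?_⟩
  · rw [hasFiniteIntegral_iff_ofReal (Eventually.of_forall hG0), hmass]
    exact ENNReal.one_lt_top
  · rw [integral_eq_lintegral_of_nonneg_ae (Eventually.of_forall hG0)
      hGm.aestronglyMeasurable, hmass, ENNReal.toReal_one]

lemma integral_gTilt (μ : Fin d → ℝ) :
    Integrable (fun x => gTilt L lstar γ x μ) ∧ ∫ x, gTilt L lstar γ x μ = 1 := by
  refine integral_sequential_truncated (fun k t => stdPdf (t - μ k))
    (fun k a => 1 - Phi (a - μ k)) (fun k t => (stdPdf_pos _).le) (fun k => ?_)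
    (fun k a => (integrable_stdPdf.comp_sub_right (μ k)).integrableOn) (fun k a => ?_)
    (fun k a => one_sub_Phi_pos _)
  · unfold stdPdf
    fun_prop
  · rw [one_sub_Phi]
    have h := (measurePreserving_sub_right (volume : Measure ℝ) (μ k)).setIntegral_preimage_emb
      (MeasurableEquiv.subRight (μ k)).measurableEmbedding stdPdf (Set.Ioi (a - μ k))
    simpa using h

lemma integral_sequential_exponential {p : Fin d → ℝ} (hp : ∀ k, 0 < p k) :
    let G := fun x : Fin d → ℝ => ∏ k, Real.exp (-p k * x k) *
      (if lTilGam L lstar γ x k ≤ x k then (1 : ℝ) else 0) /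
        (Real.exp (-p k * lTilGam L lstar γ x k) / p k)
    Integrable G ∧ ∫ x, G x = 1 := by
  refine integral_sequential_truncated (fun k t => Real.exp (-p k * t))
    (fun k a => Real.exp (-p k * a) / p k) (fun k t => (Real.exp_pos _).le)
    (fun k => by fun_prop) (fun k a => integrableOn_exp_mul_Ioi (by linarith [hp k]) a)
    (fun k a => ?_) (fun k a => div_pos (Real.exp_pos _) (hp k))
  rw [integral_exp_mul_Ioi (by linarith [hp k]), neg_div_neg_eq]

lemma lTilGam_eq (hLow : ∀ i j : Fin d, i < j → L i j = 0) (hDiag : ∀ i, 0 < L i i)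
    (x : Fin d → ℝ) (k : Fin d) :
    lTilGam L lstar γ x k =
      x k + (γ * (L * Lᵀ).mulVec lstar k - L.mulVec x k) / L k k := by
  have hsum : L.mulVec x k = ∑ j ∈ Finset.Iio k, L k j * x j + L k k * x k := by
    rw [Finset.sum_Iio_add_eq_sum_Iic (f := fun j => L k j * x j)]
    simp only [Matrix.mulVec, dotProduct]
    refine (Finset.sum_subset (Finset.subset_univ _) fun j _ hj => ?_).symm
    rw [hLow k j (by simpa using hj), zero_mul]
  have := (hDiag k).ne'
  rw [lTilGam, hsum]
  field_simp
  ring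

lemma mem_Cgam_iff (hLow : ∀ i j : Fin d, i < j → L i j = 0) (hDiag : ∀ i, 0 < L i i)
    (x : Fin d → ℝ) : x ∈ Cgam L lstar γ ↔ ∀ k, lTilGam L lstar γ x k ≤ x k := by
  refine forall_congr' fun k => ?_
  rw [lTilGam_eq hLow hDiag, add_le_iff_nonpos_right, div_nonpos_iff]
  have := hDiag k
  constructor
  · intro h; right; constructor <;> linarith
  · rintro (h | h) <;> linarith [h.1, h.2]

lemma measurableSet_Cgam : MeasurableSet (Cgam L lstar γ) := by
  simp only [Cgam, Set.ofPred_forall]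
  refine MeasurableSet.iInter fun i => measurableSet_le measurable_const ?_
  simp only [Matrix.mulVec, dotProduct]
  fun_prop

lemma phiD_pos (x : Fin d → ℝ) : 0 < phiD x := by
  unfold phiD; positivity

lemma phiD_eq_prod (x : Fin d → ℝ) : phiD x = ∏ k, stdPdf (x k) := by
  simp only [phiD, stdPdf, Finset.prod_mul_distrib, ← Real.exp_sum, Finset.sum_div, neg_div,
    Finset.sum_neg_distrib, Finset.prod_const, Finset.card_univ, Fintype.card_fin, inv_pow]

lemma integrable_phiD : Integrable (phiD : (Fin d → ℝ) → ℝ) := by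
  have : (phiD : (Fin d → ℝ) → ℝ) = fun x => ∏ k, stdPdf (x k) := funext phiD_eq_prod
  rw [this]
  exact Integrable.fintype_prod fun _ => integrable_stdPdf

lemma gTilt_nonneg (x μ : Fin d → ℝ) : 0 ≤ gTilt L lstar γ x μ :=
  Finset.prod_nonneg fun k _ => div_nonneg
    (mul_nonneg (stdPdf_pos _).le (by split_ifs <;> norm_num)) (one_sub_Phi_pos _).le

/-- On `𝒞_γ`, the proposal density is `φ_d(x) exp(-ψ_γ(x;μ))`. -/
lemma gTilt_eq (hLow : ∀ i j : Fin d, i < j → L i j = 0) (hDiag : ∀ i, 0 < L i i)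
    {x : Fin d → ℝ} (hx : x ∈ Cgam L lstar γ) (μ : Fin d → ℝ) :
    gTilt L lstar γ x μ = phiD x * Real.exp (-psiGam L lstar γ x μ) := by
  rw [mem_Cgam_iff hLow hDiag] at hx
  have hpsi : -psiGam L lstar γ x μ = ∑ k, (x k * μ k - μ k ^ 2 / 2 -
      Real.log (1 - Phi (lTilGam L lstar γ x k - μ k))) := by
    simp only [psiGam, Finset.sum_sub_distrib, Finset.sum_div]
    ring
  rw [hpsi, Real.exp_sum, phiD_eq_prod, ← Finset.prod_mul_distrib, gTilt]
  refine Finset.prod_congr rfl fun k _ => ?_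
  rw [if_pos (hx k), mul_one, Real.exp_sub, Real.exp_log (one_sub_Phi_pos _), ← mul_div_assoc]
  congr 1
  rw [stdPdf, stdPdf, mul_assoc, ← Real.exp_add]
  congr 2
  ring

lemma dotProduct_mulVec_transpose (l x : Fin d → ℝ) :
    ∑ k, l k * L.mulVec x k = ∑ k, Lᵀ.mulVec l k * x k := by
  have := Matrix.dotProduct_mulVec l L x
  rw [← Matrix.mulVec_transpose] at this
  exact this

/-- The sequential bounds tested against the weights `L_{kk} l*_k`. -/
lemma sum_mul_lTilGam (hLow : ∀ i j : Fin d, i < j → L i j = 0) (hDiag : ∀ i, 0 < L i i)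
    (x : Fin d → ℝ) :
    ∑ k, L k k * lstar k * lTilGam L lstar γ x k =
      ∑ k, L k k * lstar k * x k + γ * ∑ k, Lᵀ.mulVec lstar k ^ 2 -
        ∑ k, Lᵀ.mulVec lstar k * x k := by
  have h1 := dotProduct_mulVec_transpose (L := L) lstar x
  have h2 : ∑ k, lstar k * (L * Lᵀ).mulVec lstar k = ∑ k, Lᵀ.mulVec lstar k ^ 2 := by
    rw [← Matrix.mulVec_mulVec, dotProduct_mulVec_transpose]
    simp_rw [sq]
  rw [← h1, ← h2, Finset.mul_sum, ← Finset.sum_add_distrib, ← Finset.sum_sub_distrib]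
  refine Finset.sum_congr rfl fun k _ => ?_
  have := (hDiag k).ne'
  rw [lTilGam_eq hLow hDiag]
  field_simp
  ring

/-- Upper bound for the minimax value of `ψ_γ`. -/
noncomputable def psiUpper (L : Matrix (Fin d) (Fin d) ℝ) (lstar : Fin d → ℝ) (γ : ℝ) : ℝ :=
  -(γ ^ 2 * ∑ k, Lᵀ.mulVec lstar k ^ 2) / 2 -
    ∑ k, Real.log (Real.sqrt (2 * Real.pi) * (γ * (L k k * lstar k)))

lemma psiGam_le_psiUpper (hLow : ∀ i j : Fin d, i < j → L i j = 0) (hDiag : ∀ i, 0 < L i i)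
    (hlstar : ∀ k, 0 < lstar k) (hγ : 0 < γ) (x : Fin d → ℝ) :
    psiGam L lstar γ x (fun k => γ * Lᵀ.mulVec lstar k - γ * (L k k * lstar k)) ≤
      psiUpper L lstar γ := by
  set b := Lᵀ.mulVec lstar with hb
  set p : Fin d → ℝ := fun k => L k k * lstar k with hp
  have hppos : ∀ k, 0 < p k := fun k => mul_pos (hDiag k) (hlstar k)
  have hlog : ∀ k, Real.log (1 - Phi (lTilGam L lstar γ x k - (γ * b k - γ * p k))) ≤
      (γ * p k) ^ 2 / 2 - γ * p k * (lTilGam L lstar γ x k - (γ * b k - γ * p k)) -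
        Real.log (Real.sqrt (2 * Real.pi) * (γ * p k)) := by
    intro k
    have hr : 0 < γ * p k := mul_pos hγ (hppos k)
    refine (Real.log_le_log (one_sub_Phi_pos _) (one_sub_Phi_le hr _)).trans_eq ?_
    rw [Real.log_div (Real.exp_pos _).ne' (by positivity), Real.log_exp]
  have hsum := sum_mul_lTilGam (lstar := lstar) (γ := γ) hLow hDiag x
  refine (add_le_add_right (Finset.sum_le_sum fun k _ => hlog k) _).trans_eq ?_
  have hexpand : -(∑ i, x i * (γ * b i - γ * p i)) + (∑ i, (γ * b i - γ * p i) ^ 2) / 2 +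
      ∑ k, ((γ * p k) ^ 2 / 2 - γ * p k * (lTilGam L lstar γ x k - (γ * b k - γ * p k)) -
        Real.log (Real.sqrt (2 * Real.pi) * (γ * p k))) =
      γ * ∑ k, p k * x k - γ * ∑ k, b k * x k + γ ^ 2 * (∑ k, b k ^ 2) / 2 -
        γ * ∑ k, p k * lTilGam L lstar γ x k -
        ∑ k, Real.log (Real.sqrt (2 * Real.pi) * (γ * p k)) := by
    simp only [Finset.mul_sum, Finset.sum_div, ← Finset.sum_neg_distrib,
      ← Finset.sum_add_distrib, ← Finset.sum_sub_distrib]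
    exact Finset.sum_congr rfl fun k _ => by ring
  rw [hexpand, hsum, psiUpper]
  ring

lemma smul_mulVec_mem_Cgam : γ • Lᵀ.mulVec lstar ∈ Cgam L lstar γ := fun i => by
  rw [Matrix.mulVec_smul, Matrix.mulVec_mulVec]
  simp

lemma add_smul_mem_Cgam_iff (hγ : 0 < γ) (v : Fin d → ℝ) :
    γ • Lᵀ.mulVec lstar + γ⁻¹ • v ∈ Cgam L lstar γ ↔ v ∈ Cgam L lstar 0 := by
  refine forall_congr' fun i => ?_
  rw [Matrix.mulVec_add, Matrix.mulVec_smul, Matrix.mulVec_smul, Matrix.mulVec_mulVec]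
  have : 0 < γ⁻¹ := inv_pos.2 hγ
  simp [this]

/-- The product of exponential conditional densities on the cone `Lv ≥ 0`, in closed form. -/
lemma sequential_exponential_eq (hLow : ∀ i j : Fin d, i < j → L i j = 0)
    (hDiag : ∀ i, 0 < L i i) (v : Fin d → ℝ) :
    ∏ k, Real.exp (-(L k k * lstar k) * v k) *
      (if lTilGam L lstar 0 v k ≤ v k then (1 : ℝ) else 0) /
        (Real.exp (-(L k k * lstar k) * lTilGam L lstar 0 v k) / (L k k * lstar k)) =
    (Cgam L lstar 0).indicator (fun v => (∏ k, L k k * lstar k) *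
      Real.exp (-∑ k, Lᵀ.mulVec lstar k * v k)) v := by
  by_cases hv : v ∈ Cgam L lstar 0
  · rw [Set.indicator_of_mem hv]
    rw [mem_Cgam_iff hLow hDiag] at hv
    have hsum := sum_mul_lTilGam (lstar := lstar) (γ := 0) hLow hDiag v
    have : -∑ k, Lᵀ.mulVec lstar k * v k =
        ∑ k, (-(L k k * lstar k) * v k - -(L k k * lstar k) * lTilGam L lstar 0 v k) := by
      rw [Finset.sum_sub_distrib]
      simp only [neg_mul, Finset.sum_neg_distrib]
      linarith
    rw [this, Real.exp_sum, ← Finset.prod_mul_distrib]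
    refine Finset.prod_congr rfl fun k _ => ?_
    rw [if_pos (hv k), Real.exp_sub, mul_one, div_div_eq_mul_div]
    ring
  · rw [Set.indicator_of_notMem hv]
    rw [mem_Cgam_iff hLow hDiag] at hv
    push Not at hv
    obtain ⟨k, hk⟩ := hv
    exact Finset.prod_eq_zero (Finset.mem_univ k) (by simp [not_le.2 hk])

/-- The Gaussian tail probability, normalized by the minimax bound, as an integral over a fixed
cone. -/
lemma ellGam_mul_exp_neg_psiUpper
    (hDiag : ∀ i, 0 < L i i) (hlstar : ∀ k, 0 < lstar k) (hγ : 0 < γ) :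
    ellGam L lstar γ * Real.exp (-psiUpper L lstar γ) =
      ∫ v, (Cgam L lstar 0).indicator (fun v => (∏ k, L k k * lstar k) *
        Real.exp (-∑ k, Lᵀ.mulVec lstar k * v k)) v *
        Real.exp (-(γ⁻¹ ^ 2 * ∑ k, v k ^ 2) / 2) := by
  set b := Lᵀ.mulVec lstar with hb
  have hscale := Measure.integral_comp_smul (volume : Measure (Fin d → ℝ))
    (fun y => (Cgam L lstar γ).indicator phiD (γ • b + y)) γ⁻¹
  rw [integral_add_left_eq_self, integral_indicator measurableSet_Cgam, ← ellGam,
    Module.finrank_fin_fun, inv_pow, inv_inv, abs_of_pos (pow_pos hγ d), smul_eq_mul] at hscale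
  have hell : ellGam L lstar γ =
      (γ ^ d)⁻¹ * ∫ v, (Cgam L lstar γ).indicator phiD (γ • b + γ⁻¹ • v) := by
    rw [hscale, inv_mul_cancel_left₀ (pow_pos hγ d).ne']
  have hexp : Real.exp (-psiUpper L lstar γ) = Real.exp (γ ^ 2 * (∑ k, b k ^ 2) / 2) *
      (Real.sqrt (2 * Real.pi) ^ d * (γ ^ d * ∏ k, L k k * lstar k)) := by
    have hpos : ∀ k, 0 < Real.sqrt (2 * Real.pi) * (γ * (L k k * lstar k)) := fun k => by
      have := mul_pos (hDiag k) (hlstar k)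
      positivity
    rw [psiUpper, ← hb, neg_sub, sub_eq_add_neg, add_comm, neg_div, neg_neg, Real.exp_add,
      Real.exp_sum]
    simp_rw [Real.exp_log (hpos _)]
    simp only [Finset.prod_mul_distrib, Finset.prod_const, Finset.card_univ, Fintype.card_fin]
  rw [hell, hexp, mul_comm, ← mul_assoc, ← integral_const_mul]
  congr 1
  funext v
  by_cases hv : v ∈ Cgam L lstar 0
  · rw [Set.indicator_of_mem hv, Set.indicator_of_mem ((add_smul_mem_Cgam_iff hγ v).2 hv), phiD]
    have hsq : -(∑ i, (γ • b + γ⁻¹ • v) i ^ 2) / 2 = -(γ ^ 2 * (∑ k, b k ^ 2) / 2) +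
        (-(∑ k, b k * v k) + -(γ⁻¹ ^ 2 * ∑ k, v k ^ 2) / 2) := by
      simp only [Finset.mul_sum, Finset.sum_div, ← Finset.sum_neg_distrib,
        ← Finset.sum_add_distrib, Pi.add_apply, Pi.smul_apply, smul_eq_mul]
      refine Finset.sum_congr rfl fun k _ => ?_
      field_simp
      ring
    rw [hsq, Real.exp_add, Real.exp_add, Real.exp_neg (γ ^ 2 * (∑ k, b k ^ 2) / 2)]
    have := pow_pos hγ d
    field_simp
  · rw [Set.indicator_of_notMem hv,
      Set.indicator_of_notMem (mt (add_smul_mem_Cgam_iff hγ v).1 hv)]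
    simp

lemma tendsto_ellGam_mul_exp_neg_psiUpper (hLow : ∀ i j : Fin d, i < j → L i j = 0)
    (hDiag : ∀ i, 0 < L i i) (hlstar : ∀ k, 0 < lstar k) :
    Tendsto (fun γ => ellGam L lstar γ * Real.exp (-psiUpper L lstar γ)) atTop (nhds 1) := by
  obtain ⟨hint, hone⟩ := integral_sequential_exponential (L := L) (lstar := lstar) (γ := 0)
    (p := fun k => L k k * lstar k) fun k => mul_pos (hDiag k) (hlstar k)
  simp only [sequential_exponential_eq hLow hDiag] at hint hone
  set E := (Cgam L lstar 0).indicator (fun v => (∏ k, L k k * lstar k) *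
        Real.exp (-∑ k, Lᵀ.mulVec lstar k * v k)) with hE
  have hlim : Tendsto (fun γ : ℝ => ∫ v, E v * Real.exp (-(γ⁻¹ ^ 2 * ∑ k, v k ^ 2) / 2))
      atTop (nhds (∫ v, E v)) := by
    refine tendsto_integral_filter_of_dominated_convergence (fun v => ‖E v‖)
      (Eventually.of_forall fun γ => ?_) (Eventually.of_forall fun γ =>
        Eventually.of_forall fun v => ?_) hint.norm (Eventually.of_forall fun v => ?_)
    · exact hint.aestronglyMeasurable.mul (Continuous.aestronglyMeasurable (by fun_prop))
    · rw [norm_mul]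
      refine mul_le_of_le_one_right (norm_nonneg _) ?_
      rw [Real.norm_eq_abs, Real.abs_exp, Real.exp_le_one_iff]
      have : 0 ≤ γ⁻¹ ^ 2 * ∑ k, v k ^ 2 := by positivity
      linarith
    · have hc : Continuous fun s : ℝ => E v * Real.exp (-(s ^ 2 * ∑ k, v k ^ 2) / 2) := by
        fun_prop
      simpa [Function.comp_def] using (hc.tendsto 0).comp tendsto_inv_atTop_zero
  rw [hone] at hlim
  refine hlim.congr' ?_
  filter_upwards [eventually_gt_atTop 0] with γ hγ
  exact (ellGam_mul_exp_neg_psiUpper hDiag hlstar hγ).symm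

lemma eventually_psiUpper_neg (hd : 1 ≤ d) (hDiag : ∀ i, 0 < L i i)
    (hlstar : ∀ k, 0 < lstar k) : ∀ᶠ γ in atTop, psiUpper L lstar γ < 0 := by
  have h : ∀ k, ∀ᶠ γ : ℝ in atTop,
      1 < Real.sqrt (2 * Real.pi) * (γ * (L k k * lstar k)) := fun k => by
    have hp := mul_pos (hDiag k) (hlstar k)
    exact ((tendsto_id.atTop_mul_const hp).const_mul_atTop
      (by positivity : 0 < Real.sqrt (2 * Real.pi))).eventually_gt_atTop 1
  filter_upwards [eventually_all.2 h] with γ hγ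
  have : Nonempty (Fin d) := ⟨⟨0, hd⟩⟩
  have h1 : 0 < ∑ k, Real.log (Real.sqrt (2 * Real.pi) * (γ * (L k k * lstar k))) :=
    Finset.sum_pos (fun k _ => Real.log_pos (hγ k)) Finset.univ_nonempty
  have h2 : 0 ≤ γ ^ 2 * ∑ k, Lᵀ.mulVec lstar k ^ 2 := by positivity
  rw [psiUpper]
  linarith

/-- A density dominating `c` times another one is within `1 - c` of it in total variation. -/
lemma abs_setIntegral_sub_le {α : Type*} [MeasurableSpace α] {ν : Measure α} {f g : α → ℝ}
    {c : ℝ} (hf : Integrable f ν) (hg : Integrable g ν) (hf0 : ∀ x, 0 ≤ f x)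
    (hf1 : ∫ x, f x ∂ν = 1) (hg1 : ∫ x, g x ∂ν = 1) (hfg : ∀ x, c * f x ≤ g x)
    {A : Set α} (hA : MeasurableSet A) :
    |(∫ x in A, f x ∂ν) - ∫ x in A, g x ∂ν| ≤ 1 - c := by
  have hc : c ≤ 1 := by
    have := integral_mono (hf.const_mul c) hg hfg
    rwa [integral_const_mul, hf1, hg1, mul_one] at this
  have key : ∀ B : Set α, (∫ x in B, f x ∂ν) - ∫ x in B, g x ∂ν ≤ 1 - c := by
    intro B
    have h1 := setIntegral_mono (s := B) (hf.const_mul c).integrableOn hg.integrableOn hfg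
    rw [integral_const_mul] at h1
    have h2 : ∫ x in B, f x ∂ν ≤ 1 :=
      (setIntegral_le_integral hf (Eventually.of_forall hf0)).trans_eq hf1
    nlinarith
  have hfA := integral_add_compl hA hf
  have hgA := integral_add_compl hA hg
  rw [abs_le]
  constructor
  · linarith [key Aᶜ]
  · exact key A

end Sequential

/-- Corollary 4, asymptotically efficient simulation: the minimax tilted
proposal g_γ(·;μ*(γ)) converges to the truncated normal target f_γ in total variation:
sup over Borel sets 𝒜 of |∫_𝒜 f_γ − ∫_𝒜 g_γ(·;μ*(γ))| → 0 as γ → ∞. -/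
theorem proposal_tv_convergence {d : ℕ} (hd : 1 ≤ d)
    (L : Matrix (Fin d) (Fin d) ℝ)
    (hLow : ∀ i j : Fin d, i < j → L i j = 0)
    (hDiag : ∀ i, 0 < L i i)
    (lstar : Fin d → ℝ) (hlstar : ∀ k, 0 < lstar k)
    (μstar : ℝ → Fin d → ℝ)
    (hmin : ∀ γ : ℝ, 0 < γ → ∀ μ : Fin d → ℝ,
      sSup ((fun x => psiGam L lstar γ x (μstar γ)) '' Cgam L lstar γ) ≤
        sSup ((fun x => psiGam L lstar γ x μ) '' Cgam L lstar γ)) :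
    Tendsto
      (fun γ : ℝ =>
        ⨆ A : {A : Set (Fin d → ℝ) // MeasurableSet A},
          |(∫ x in A.1, fTrunc L lstar γ x) - ∫ x in A.1, gTilt L lstar γ x (μstar γ)|)
      atTop (nhds 0) := by
  have hlim := tendsto_ellGam_mul_exp_neg_psiUpper hLow hDiag hlstar
  have hlim0 : Tendsto
      (fun γ => 1 - ellGam L lstar γ * Real.exp (-psiUpper L lstar γ)) atTop (nhds 0) := by
    simpa using hlim.const_sub 1
  refine squeeze_zero' (Eventually.of_forall fun γ => Real.iSup_nonneg fun A => abs_nonneg _)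
    ?_ hlim0
  filter_upwards [eventually_gt_atTop 0, eventually_psiUpper_neg hd hDiag hlstar,
    hlim.eventually_const_lt zero_lt_one] with γ hγ hneg hpos
  have hell : 0 < ellGam L lstar γ := pos_of_mul_pos_left hpos (Real.exp_pos _).le
  have hsup : sSup ((fun x => psiGam L lstar γ x (μstar γ)) '' Cgam L lstar γ) ≤
      psiUpper L lstar γ := by
    refine (hmin γ hγ
      fun k => γ * Lᵀ.mulVec lstar k - γ * (L k k * lstar k)).trans
        (csSup_le (Set.Nonempty.image _ ⟨_, smul_mulVec_mem_Cgam⟩) ?_)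
    rintro _ ⟨x, -, rfl⟩
    exact psiGam_le_psiUpper hLow hDiag hlstar hγ x
  -- An unbounded image would have the junk supremum `0`, which is too large.
  have hbdd : BddAbove ((fun x => psiGam L lstar γ x (μstar γ)) '' Cgam L lstar γ) := by
    by_contra h
    rw [Real.sSup_of_not_bddAbove h] at hsup
    linarith
  have hf_int : Integrable (fTrunc L lstar γ) :=
    (integrable_phiD.indicator measurableSet_Cgam).div_const _
  have hf_one : ∫ x, fTrunc L lstar γ x = 1 := by
    simp only [fTrunc]
    rw [integral_div, integral_indicator measurableSet_Cgam, ← ellGam, div_self hell.ne']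
  refine ciSup_le fun A => abs_setIntegral_sub_le hf_int (integral_gTilt _).1
    (fun x => div_nonneg (Set.indicator_nonneg (fun y _ => (phiD_pos y).le) x) hell.le)
    hf_one (integral_gTilt _).2 (fun x => ?_) A.2
  by_cases hx : x ∈ Cgam L lstar γ
  · rw [gTilt_eq hLow hDiag hx, fTrunc, Set.indicator_of_mem hx]
    have hpsi : psiGam L lstar γ x (μstar γ) ≤ psiUpper L lstar γ :=
      (le_csSup hbdd ⟨x, hx, rfl⟩).trans hsup
    calc ellGam L lstar γ * Real.exp (-psiUpper L lstar γ) * (phiD x / ellGam L lstar γ)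
        = phiD x * Real.exp (-psiUpper L lstar γ) := by field_simp
      _ ≤ _ := by
        have := (phiD_pos x).le
        gcongr
  · rw [fTrunc, Set.indicator_of_notMem hx, zero_div, mul_zero]
    exact gTilt_nonneg _ _
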